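/- arXiv:2510.12973 — 2 statements merged into one kernel-verified Lean document; each statement's English description precedes it below -/
import Mathlib

section
/- Let k be a field of characteristic p > 0 with [k : k^p] = p. Then every finite purely inseparable field extension k'/k is equal to k^(p^{-n}) for some n ≥ 0, i.e. k' = {x : x^(p^n) ∈ k} inside a fixed algebraic closure. Equivalently, for each degree p^n there is at most one purely inseparable subextension of that degree. -/
/-- Let `k` be a field of characteristic `p > 0` with `[k : k^p] = p`. Then every finite
purely inseparable extension `k'/k` inside a fixed algebraic closure equals
`k^(p^{-n}) = {x | x ^ p ^ n ∈ k}` for some `n`. -/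
theorem stmt1 (p : ℕ) [Fact p.Prime] (k : Type*) [Field k] [CharP k p]
    (hk : Module.finrank (frobenius k p).fieldRange k = p)
    (k' : IntermediateField k (AlgebraicClosure k))
    [FiniteDimensional k k'] [IsPurelyInseparable k k'] :
    ∃ n : ℕ, ∀ x : AlgebraicClosure k,
      x ∈ k' ↔ x ^ p ^ n ∈ (algebraMap k (AlgebraicClosure k)).range := by
  classical
  have hp : p.Prime := Fact.out
  haveI : ExpChar k p := ExpChar.prime hp
  haveI : CharP (AlgebraicClosure k) p := charP_of_injective_algebraMap
    (algebraMap k (AlgebraicClosure k)).injective p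
  haveI : ExpChar (AlgebraicClosure k) p := ExpChar.prime hp
  have hex : ∃ n : ℕ, ∀ x ∈ k', x ^ p ^ n ∈ (algebraMap k (AlgebraicClosure k)).range := by
    obtain ⟨e, he⟩ := (IsPurelyInseparable.hasExponent_iff' k k' p).1 inferInstance
    refine ⟨e, fun x hx => ?_⟩
    obtain ⟨c, hc⟩ := he ⟨x, hx⟩
    exact ⟨c, congrArg Subtype.val hc⟩
  have hn := Nat.find_spec hex
  have hmin := fun m => @Nat.find_min _ _ hex m
  generalize Nat.find hex = n at hn hmin
  refine ⟨n, fun x => ⟨hn x, ?_⟩⟩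
  have inj : ∀ (m : ℕ) (u v : AlgebraicClosure k), u ^ p ^ m = v ^ p ^ m → u = v := by
    intro m u v h
    apply iterateFrobenius_inj (AlgebraicClosure k) p m
    simpa [iterateFrobenius_def] using h
  have key : ∀ m ≤ n, ∀ y : k, ∃ z ∈ k', z ^ p ^ m = algebraMap k (AlgebraicClosure k) y := by
    intro m
    induction m with
    | zero => intro _ y; exact ⟨_, k'.algebraMap_mem y, by simp⟩
    | succ m ih =>
      intro hm y
      have ih := ih (by omega)
      have := hmin (n - 1) (by omega)
      push Not at this
      obtain ⟨a, ha, hna⟩ := this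
      obtain ⟨b, hb⟩ := hn a ha
      let F : Subfield k := (k'.toSubfield.map (iterateFrobenius (AlgebraicClosure k) p (m+1))).comap
        (algebraMap k (AlgebraicClosure k))
      have hF : ∀ y, y ∈ F ↔ ∃ z ∈ k', z ^ p ^ (m+1) = algebraMap k (AlgebraicClosure k) y := by
        intro y
        simp [F, Subfield.mem_comap, Subfield.mem_map, iterateFrobenius_def]
      let G : IntermediateField (frobenius k p).fieldRange k :=
        F.toIntermediateField (by
          rintro ⟨_, c, rfl⟩
          obtain ⟨z, hz, hzc⟩ := ih c
          refine (hF _).2 ⟨z, hz, ?_⟩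
          change _ = algebraMap k (AlgebraicClosure k) (frobenius k p c)
          rw [pow_succ, pow_mul, hzc, frobenius_def, map_pow])
      have hbF : b ∈ F := (hF b).2 ⟨a ^ p ^ (n - (m+1)), pow_mem ha _, by
        rw [← pow_mul, ← pow_add, hb]; congr 2; omega⟩
      haveI : IsSimpleOrder (IntermediateField (frobenius k p).fieldRange k) :=
        IntermediateField.isSimpleOrder_of_finrank_prime _ _ (by rw [hk]; exact hp)
      rcases eq_bot_or_eq_top G with h | h
      · exfalso
        have hbG : b ∈ G := hbF
        rw [h, IntermediateField.mem_bot] at hbG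
        obtain ⟨⟨_, c, rfl⟩, hc⟩ := hbG
        change frobenius k p c = b at hc
        apply hna
        refine ⟨c, inj 1 _ _ ?_⟩
        rw [← pow_mul, ← pow_add, Nat.sub_add_cancel (by omega), ← hb, ← hc, frobenius_def,
          map_pow, pow_one]
      · have : y ∈ G := h ▸ IntermediateField.mem_top
        exact (hF y).1 this
  rintro ⟨y, hy⟩
  obtain ⟨z, hz, hzy⟩ := key n le_rfl y
  rwa [inj n x z (by rw [hzy, hy])]
end

section
/- Let k be a field of characteristic p > 0 with [k : k^p] = p, and let K'/k be a finite field extension. Then there exist intermediate fields K and k' of K'/k such that K/k is separable, k'/k is purely inseparable, and K' = K·k', with the natural map K ⊗_k k' → K' an isomorphism of k-algebras. -/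
theorem stmt2_map_mono {E L : Type*} [Field E] [Field L] (f : E →+* L) {A B : Subfield E}
    (h : A ≤ B) : A.map f ≤ B.map f := by
  rintro _ ⟨x, hx, rfl⟩
  exact ⟨x, h hx, rfl⟩

theorem stmt2_aux_deg {E : Type*} [Field E] (f : E →+* E) (k₀ : Subfield E) (p : ℕ)
    (hle : k₀.map f ≤ k₀) (h : Subfield.relfinrank (k₀.map f) k₀ = p) (n : ℕ) :
    k₀.map (f ^ n) ≤ k₀ ∧ Subfield.relfinrank (k₀.map (f ^ n)) k₀ = p ^ n := by
  induction n with
  | zero =>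
    have : k₀.map (f ^ 0) = k₀ := by
      rw [pow_zero]; ext x; simp [Subfield.mem_map]
    rw [this]; simp
  | succ n ih =>
    have e : k₀.map (f ^ (n + 1)) = (k₀.map (f ^ n)).map f := by
      rw [Subfield.map_map, pow_succ']; rfl
    have h1 : (k₀.map (f ^ n)).map f ≤ k₀.map f := stmt2_map_mono _ ih.1
    refine ⟨by rw [e]; exact h1.trans hle, ?_⟩
    rw [e, ← Subfield.relfinrank_mul_relfinrank h1 hle, Subfield.relfinrank_map_map, ih.2, h,
      pow_succ]

theorem stmt2_aux_pow {p : ℕ} (F E : Type*) [Field F] [Field E] [Algebra F E] [hp : Fact p.Prime]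
    [ExpChar F p] [FiniteDimensional F E] [IsPurelyInseparable F E] (n : ℕ)
    (hn : Module.finrank F E = p ^ n) (x : E) : x ^ p ^ n ∈ (algebraMap F E).fieldRange := by
  obtain ⟨m, y, e⟩ := IsPurelyInseparable.minpoly_eq_X_pow_sub_C F p x
  have h1 : (minpoly F x).natDegree ∣ Module.finrank F E := minpoly.degree_dvd
    (Algebra.IsIntegral.isIntegral x)
  rw [e, hn, Polynomial.natDegree_sub_C, Polynomial.natDegree_X_pow] at h1
  have hmn : m ≤ n := (Nat.pow_dvd_pow_iff_le_right hp.out.one_lt).1 h1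
  have h2 := minpoly.aeval F x
  rw [e] at h2
  simp only [map_sub, map_pow, Polynomial.aeval_X, Polynomial.aeval_C, sub_eq_zero] at h2
  refine ⟨y ^ p ^ (n - m), ?_⟩
  rw [map_pow, ← h2, ← pow_mul, ← pow_add, Nat.add_sub_cancel' hmn]

/-- Let `k` be a field of characteristic `p > 0` with `[k : k^p] = p`, and `K'/k` a finite
field extension. Then there are intermediate fields `K` (separable over `k`) and `k''`
(purely inseparable over `k`) with `K' = K·k''` and the natural map `K ⊗[k] k'' → K'`
an isomorphism of `k`-algebras. -/
theorem stmt2 (p : ℕ) [Fact p.Prime] (k K' : Type*) [Field k] [Field K'] [CharP k p]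
    [Algebra k K'] [FiniteDimensional k K']
    (hk : Module.finrank (frobenius k p).fieldRange k = p) :
    ∃ (K k'' : IntermediateField k K'),
      Algebra.IsSeparable k K ∧ IsPurelyInseparable k k'' ∧ K ⊔ k'' = ⊤ ∧
      Function.Bijective (Algebra.TensorProduct.productMap K.val k''.val) := by
  have hp : p.Prime := Fact.out
  have : CharP K' p := charP_of_injective_algebraMap (algebraMap k K').injective p
  let K := separableClosure k K'
  have : ExpChar K p := expChar_of_injective_algebraMap (algebraMap k K).injective p
  have : IsPurelyInseparable K K' := separableClosure.isPurelyInseparable k K'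
  obtain ⟨n, hn⟩ := IsPurelyInseparable.finrank_eq_pow (F := K) K' p
  let f := frobenius K' p
  let g : K' →+* K' := f ^ n
  have hg : ∀ x, g x = x ^ p ^ n := fun x => by
    change (f ^ n) x = _
    rw [RingHom.coe_pow]
    exact iterate_frobenius p n x
  let k₀ : Subfield K' := (algebraMap k K').fieldRange
  have hmap : k₀.map f = (frobenius k p).fieldRange.map (algebraMap k K') := by
    ext x
    simp [k₀, f, frobenius_def]
  have hk₀ : k₀ = (⊤ : Subfield k).map (algebraMap k K') := RingHom.fieldRange_eq_map _
  have hle : k₀.map f ≤ k₀ := by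
    rw [hmap, hk₀]; exact stmt2_map_mono _ le_top
  have hdeg : Subfield.relfinrank (k₀.map f) k₀ = p := by
    rw [hmap, hk₀, Subfield.relfinrank_map_map, Subfield.relfinrank_top_right, hk]
  obtain ⟨hle', hdeg'⟩ := stmt2_aux_deg f k₀ p hle hdeg n
  change k₀.map g ≤ k₀ at hle'
  change Subfield.relfinrank (k₀.map g) k₀ = p ^ n at hdeg'
  have hbot : (⊥ : IntermediateField k K').toSubfield = k₀ := IntermediateField.bot_toSubfield
  have hfr : ∀ L : IntermediateField k K',
      Subfield.relfinrank k₀ L.toSubfield = Module.finrank k L := fun L => by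
    rw [← hbot]; exact IntermediateField.relfinrank_bot_left L
  have hd : Subfield.relfinrank k₀ ⊤ = Module.finrank k K' := by
    have := hfr ⊤
    rwa [IntermediateField.top_toSubfield, IntermediateField.finrank_top'] at this
  have hd0 : 0 < Module.finrank k K' := Module.finrank_pos
  have hr : Subfield.relfinrank ((⊤ : Subfield K').map g) ⊤ = p ^ n := by
    have h1 := Subfield.relfinrank_mul_relfinrank hle' (le_top : k₀ ≤ ⊤)
    have h2 := Subfield.relfinrank_mul_relfinrank
      (stmt2_map_mono g (le_top : k₀ ≤ ⊤)) le_top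
    rw [Subfield.relfinrank_map_map, ← h1, hd, hdeg', mul_comm] at h2
    exact Nat.eq_of_mul_eq_mul_right hd0 h2
  have hKn : Subfield.relfinrank K.toSubfield ⊤ = p ^ n := by
    rw [Subfield.relfinrank_top_right]; exact hn
  have hgK : (⊤ : Subfield K').map g ≤ K.toSubfield := by
    rintro _ ⟨x, -, rfl⟩
    change g x ∈ K
    rw [hg]
    obtain ⟨y, hy⟩ := stmt2_aux_pow K K' n hn x
    rw [← hy]; exact y.2
  have hKg : K.toSubfield ≤ (⊤ : Subfield K').map g := by
    rw [← Subfield.relfinrank_eq_one_iff]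
    have h := Subfield.relfinrank_mul_relfinrank hgK le_top
    rw [hKn, hr] at h
    exact Nat.eq_of_mul_eq_mul_right (pow_pos hp.pos n) (by rw [h, one_mul])
  have hk₀g : k₀ ≤ g.fieldRange := by
    rw [RingHom.fieldRange_eq_map]
    refine le_trans ?_ hKg
    rintro _ ⟨x, rfl⟩
    exact K.algebraMap_mem x
  let k'' : IntermediateField k K' := (k₀.comap g).toIntermediateField (fun x => by
    change g _ ∈ k₀
    rw [hg, ← map_pow]
    exact ⟨_, rfl⟩)
  have hk''s : k''.toSubfield = k₀.comap g := rfl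
  have hk''n : Module.finrank k k'' = p ^ n := by
    rw [← hfr, hk''s, ← Subfield.relfinrank_map_map _ _ g, Subfield.map_comap_eq,
      inf_eq_left.2 hk₀g, hdeg']
  have hsep : Algebra.IsSeparable k K := separableClosure.isSeparable k K'
  have hpi : IsPurelyInseparable k k'' := by
    rw [isPurelyInseparable_iff_pow_mem k p]
    intro x
    have hx : g x.1 ∈ k₀ := x.2
    rw [hg] at hx
    obtain ⟨y, hy⟩ := hx
    exact ⟨n, y, Subtype.ext hy⟩
  have hld : K.LinearDisjoint k'' :=
    IntermediateField.linearDisjoint_of_isPurelyInseparable_of_isSeparable k'' K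
  have htop : K ⊔ k'' = ⊤ := by
    apply IntermediateField.eq_of_le_of_finrank_eq le_top
    rw [hld.finrank_sup, hk''n, ← hn, IntermediateField.finrank_top',
      Module.finrank_mul_finrank]
  refine ⟨K, k'', hsep, hpi, htop, ?_, ?_⟩
  · exact (IntermediateField.linearDisjoint_iff'.1 hld).injective
  · rw [← AlgHom.range_eq_top, Algebra.TensorProduct.productMap_range,
      IntermediateField.range_val, IntermediateField.range_val,
      ← IntermediateField.sup_toSubalgebra_of_left, htop, IntermediateField.top_toSubalgebra]
end
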